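/- arXiv:1409.5081 — 2 statements merged into one kernel-verified Lean document; each statement's English description precedes it below -/
import Mathlib

section
/- Let f₁ : ℝⁿ → ℝ be a continuous convex function. Then there exists a constant c₂ = c₂(D, f₁) > 0 such that for every curve r ∈ ℘̃(D) one has Var(Φ₁'; 0, T_r) ≤ c₂·(1 + Var(r'; 0, T_r)), where Φ₁(t) = f₁(r(t)) for t ∈ [0, T_r]. -/
open Set MeasureTheory Filter Topology

/-- `r : [0,T] → E` is an arc-length parametrization: `r` is 1-Lipschitz on `[0,T]`
and `‖r'(t)‖ = 1` at almost every `t ∈ [0,T]`. -/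
def IsArcLengthOn {E : Type*} [NormedAddCommGroup E] [NormedSpace ℝ E]
    (r : ℝ → E) (T : ℝ) : Prop :=
  LipschitzOnWith 1 r (Set.Icc 0 T) ∧
  ∀ᵐ t ∂(volume.restrict (Set.Icc 0 T)), DifferentiableAt ℝ r t ∧ ‖deriv r t‖ = 1

/-- The variation `Var(g'; 0, T)` of the derivative of `g` over the points of
differentiability of `g` inside `[0,T]`:
`sup Σᵢ ‖g'(tᵢ) − g'(tᵢ₋₁)‖` over finite monotone families of such points. -/
noncomputable def derivVar {E : Type*} [NormedAddCommGroup E] [NormedSpace ℝ E]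
    (g : ℝ → E) (T : ℝ) : ENNReal :=
  eVariationOn (deriv g) {t | t ∈ Set.Icc 0 T ∧ DifferentiableAt ℝ g t}

/-- The orthogonal projection of `ℝⁿ` onto the coordinate plane spanned by the
`i`-th and `j`-th coordinate axes, viewed as a map to `ℝ²`. -/
noncomputable def coordProj2 {n : ℕ} (i j : Fin n) (v : EuclideanSpace ℝ (Fin n)) :
    EuclideanSpace ℝ (Fin 2) :=
  (WithLp.equiv 2 (Fin 2 → ℝ)).symm ![v i, v j]

/-- The class `℘̃(D)` of closed arc-length-parametrized curves `r : [0,T] → ℝⁿ`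
lying in `D` for which there is a coordinate plane `Π_r` (spanned by two
coordinate axes, indexed by `i ≠ j`) such that:
the orthogonal projection of `r` onto `Π_r` is injective and is the boundary
curve of a convex compact subset of the projection of `D`, and the angles that
the vectors `r(t)` and `r'(t)` form with `Π_r` do not exceed `π/4` (i.e. the
norm of the projection is at least `(√2/2)` times the norm of the vector). -/
def MemCurveClassTilde {n : ℕ} (D : Set (EuclideanSpace ℝ (Fin n)))
    (r : ℝ → EuclideanSpace ℝ (Fin n)) (T : ℝ) : Prop :=
  0 < T ∧ IsArcLengthOn r T ∧ (∀ t ∈ Set.Icc 0 T, r t ∈ D) ∧ r 0 = r T ∧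
  ∃ i j : Fin n, i ≠ j ∧
    Set.InjOn (fun t => coordProj2 i j (r t)) (Set.Ico 0 T) ∧
    (∃ C : Set (EuclideanSpace ℝ (Fin 2)), Convex ℝ C ∧ IsCompact C ∧
      C ⊆ (coordProj2 i j) '' D ∧
      (fun t => coordProj2 i j (r t)) '' Set.Icc 0 T = frontier C) ∧
    (∀ t ∈ Set.Icc 0 T, Real.sqrt 2 / 2 * ‖r t‖ ≤ ‖coordProj2 i j (r t)‖) ∧
    (∀ t ∈ Set.Icc 0 T, DifferentiableAt ℝ r t →
      Real.sqrt 2 / 2 * ‖deriv r t‖ ≤ ‖coordProj2 i j (deriv r t)‖)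

open scoped NNReal

section SecondDifference

variable {E : Type*} [NormedAddCommGroup E] [NormedSpace ℝ E]

/-- The sum of the norms of the second differences of a Lipschitz curve `r` along a partition of
`[s, t]` with step `h` is at most `h` times the variation of the derivative of `r`. -/
lemma sum_norm_second_difference_le {r : ℝ → E} {K : ℝ≥0} {s t h : ℝ} {m : ℕ} (hh : 0 ≤ h)
    (ht : s + (m + 1) * h = t) (hr : LipschitzOnWith K r (Icc s t))
    (hd : ∀ᵐ u, u ∈ Icc s t → DifferentiableAt ℝ r u)
    (hV : eVariationOn (deriv r) {u | u ∈ Icc s t ∧ DifferentiableAt ℝ r u} ≠ ⊤) :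
    ∑ k ∈ Finset.range m,
        ‖r (s + (k + 1) * h + h) - r (s + k * h + h) - (r (s + (k + 1) * h) - r (s + k * h))‖ ≤
      (eVariationOn (deriv r) {u | u ∈ Icc s t ∧ DifferentiableAt ℝ r u}).toReal * h := by
  set S := {u | u ∈ Icc s t ∧ DifferentiableAt ℝ r u} with hS
  set V := (eVariationOn (deriv r) S).toReal with hVdef
  choose g hg1 hg using fun x : E => exists_dual_vector'' ℝ x
  set e : ℕ → StrongDual ℝ E := fun k => g
    (r (s + (k + 1) * h + h) - r (s + k * h + h) - (r (s + (k + 1) * h) - r (s + k * h))) with he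
  set F : ℝ → ℝ := fun u => ∑ k ∈ Finset.range m,
    e k (r (s + (k + 1) * h + u) - r (s + k * h + u)) with hF
  have hmem : ∀ k : ℕ, k ≤ m → ∀ u ∈ Icc 0 h, s + k * h + u ∈ Icc s t := by
    intro k hk u hu
    have hk' : (k : ℝ) ≤ m := by exact_mod_cast hk
    have := mul_le_mul_of_nonneg_right hk' hh
    have : 0 ≤ (k : ℝ) * h := by positivity
    constructor <;> nlinarith [hu.1, hu.2]
  have hmem' : ∀ k ∈ Finset.range m, ∀ u ∈ Icc 0 h, s + (k + 1) * h + u ∈ Icc s t := by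
    intro k hk u hu
    have := hmem (k + 1) (by simpa using hk) u hu
    simpa using this
  have hFlip : LipschitzOnWith (∑ _k ∈ Finset.range m, (K + K)) F (uIcc 0 h) := by
    rw [uIcc_of_le hh]
    refine LipschitzOnWith.of_dist_le_mul fun u hu v hv => ?_
    rw [Real.dist_eq, hF]
    simp only
    rw [← Finset.sum_sub_distrib]
    refine (Finset.abs_sum_le_sum_abs _ _).trans ?_
    push_cast
    rw [Finset.sum_mul]
    refine Finset.sum_le_sum fun k hk => ?_
    rw [← map_sub, ← Real.norm_eq_abs]
    refine ((e k).le_of_opNorm_le (hg1 _) _).trans ?_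
    have h1 := hr.dist_le_mul _ (hmem' k hk u hu) _ (hmem' k hk v hv)
    have h2 := hr.dist_le_mul _ (hmem k (Finset.mem_range.1 hk).le u hu) _
      (hmem k (Finset.mem_range.1 hk).le v hv)
    rw [dist_add_left, dist_eq_norm] at h1 h2
    rw [one_mul, add_mul (K : ℝ), sub_sub_sub_comm]
    exact (norm_sub_le _ _).trans (add_le_add h1 h2)
  have hFac := hFlip.absolutelyContinuousOnInterval
  have hae : ∀ᵐ u, ∀ k : ℕ, s + k * h + u ∈ Icc s t → DifferentiableAt ℝ r (s + k * h + u) := by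
    rw [ae_all_iff]
    intro k
    exact (measurePreserving_add_left volume (s + k * h)).quasiMeasurePreserving.ae hd
  have hderiv : ∀ᵐ u ∂volume.restrict (Icc 0 h), deriv F u ≤ V := by
    rw [ae_restrict_iff' measurableSet_Icc]
    filter_upwards [hae] with u hu huI
    have hD : ∀ k : ℕ, k ≤ m → s + k * h + u ∈ S := fun k hk =>
      ⟨hmem k hk u huI, hu k (hmem k hk u huI)⟩
    have hD' : ∀ k ∈ Finset.range m, s + (k + 1) * h + u ∈ S := by
      intro k hk
      have := hD (k + 1) (by simpa using hk)
      simpa using this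
    have hFd : HasDerivAt F (∑ k ∈ Finset.range m,
        e k (deriv r (s + (k + 1) * h + u) - deriv r (s + k * h + u))) u := by
      refine HasDerivAt.fun_sum fun k hk => ?_
      refine (e k).hasFDerivAt.comp_hasDerivAt u (HasDerivAt.sub ?_ ?_)
      · exact (hD' k hk).2.hasDerivAt.comp_const_add _ _
      · exact (hD k (Finset.mem_range.1 hk).le).2.hasDerivAt.comp_const_add _ _
    rw [hFd.deriv]
    have hsum := eVariationOn.sum_le_of_monotoneOn_Iic (f := deriv r) (s := S) (n := m)
      (u := fun k => s + k * h + u)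
      (fun i _ j _ hij => by
        have : (i : ℝ) ≤ j := by exact_mod_cast hij
        have := mul_le_mul_of_nonneg_right this hh
        simp only
        linarith) (fun k hk => hD k hk)
    have hsum' : ∑ k ∈ Finset.range m,
        dist (deriv r (s + (k + 1) * h + u)) (deriv r (s + k * h + u)) ≤ V := by
      rw [hVdef, ← ENNReal.ofReal_le_iff_le_toReal hV,
        ENNReal.ofReal_sum_of_nonneg fun _ _ => dist_nonneg]
      simpa [edist_dist] using hsum
    refine (Finset.sum_le_sum fun k _ => ?_).trans hsum'
    rw [dist_eq_norm]
    refine (Real.le_norm_self _).trans (((e k).le_of_opNorm_le (hg1 _) _).trans ?_)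
    rw [one_mul]
  have hint := intervalIntegral.integral_mono_ae_restrict hh hFac.intervalIntegrable_deriv
    (intervalIntegrable_const (c := V)) hderiv
  rw [hFac.integral_deriv_eq_sub, intervalIntegral.integral_const] at hint
  refine le_trans (le_of_eq ?_) (hint.trans (le_of_eq ?_))
  · rw [hF]
    simp only [add_zero]
    rw [← Finset.sum_sub_distrib]
    refine Finset.sum_congr rfl fun k _ => ?_
    rw [← map_sub, he]
    exact (hg _).symm
  · simp [mul_comm]

/-- The second difference of a convex function that is `L`-Lipschitz on a convex set. -/
lemma ConvexOn.second_difference_ge {D : Set E} {f : E → ℝ} {L : ℝ≥0} (hf : ConvexOn ℝ D f)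
    (hL : LipschitzOnWith L f D) {x y z : E} (hx : x ∈ D) (hy : y ∈ D) (hz : z ∈ D) :
    -(L * ‖z - y - (y - x)‖) ≤ f z - f y - (f y - f x) := by
  have hmid : (1 / 2 : ℝ) • x + (1 / 2 : ℝ) • z ∈ D :=
    hf.1 hx hz (by norm_num) (by norm_num) (by norm_num)
  have h1 : f ((1 / 2 : ℝ) • x + (1 / 2 : ℝ) • z) ≤ (1 / 2 : ℝ) • f x + (1 / 2 : ℝ) • f z :=
    hf.2 hx hz (by norm_num) (by norm_num) (by norm_num)
  have h2 := hL.dist_le_mul _ hy _ hmid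
  have h3 : dist y ((1 / 2 : ℝ) • x + (1 / 2 : ℝ) • z) = 1 / 2 * ‖z - y - (y - x)‖ := by
    rw [dist_comm, dist_eq_norm, ← abs_of_pos (show (0 : ℝ) < 1 / 2 by norm_num),
      ← Real.norm_eq_abs, ← norm_smul, Real.norm_eq_abs, abs_of_pos (by norm_num)]
    congr 1
    module
  rw [h3, Real.dist_eq] at h2
  have h4 := le_abs_self (f y - f ((1 / 2 : ℝ) • x + (1 / 2 : ℝ) • z))
  simp only [smul_eq_mul] at h1
  linarith

/-- Along a Lipschitz curve, the derivative of a convex function decreases by at most the Lipschitz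
constant times the variation of the derivative of the curve. -/
lemma ConvexOn.deriv_comp_sub_ge {D : Set E} {f : E → ℝ} {L K : ℝ≥0} (hf : ConvexOn ℝ D f)
    (hL : LipschitzOnWith L f D) {r : ℝ → E} {s t : ℝ} (hst : s < t)
    (hrD : ∀ u ∈ Icc s t, r u ∈ D) (hr : LipschitzOnWith K r (Icc s t))
    (hd : ∀ᵐ u, u ∈ Icc s t → DifferentiableAt ℝ r u)
    (hV : eVariationOn (deriv r) {u | u ∈ Icc s t ∧ DifferentiableAt ℝ r u} ≠ ⊤)
    (hs : DifferentiableAt ℝ (fun u => f (r u)) s)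
    (ht : DifferentiableAt ℝ (fun u => f (r u)) t) :
    -(L * (eVariationOn (deriv r) {u | u ∈ Icc s t ∧ DifferentiableAt ℝ r u}).toReal) ≤
      deriv (fun u => f (r u)) t - deriv (fun u => f (r u)) s := by
  set V := (eVariationOn (deriv r) {u | u ∈ Icc s t ∧ DifferentiableAt ℝ r u}).toReal
  set Φ : ℝ → ℝ := fun u => f (r u) with hΦ
  set h : ℕ → ℝ := fun m => (t - s) * (1 / ((m : ℝ) + 1)) with hh
  have hpos : ∀ m, 0 < h m := fun m => mul_pos (sub_pos.2 hst) (by positivity)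
  have hlim0 : Tendsto h atTop (𝓝 0) := by
    simpa [hh] using (tendsto_one_div_add_atTop_nhds_zero_nat (𝕜 := ℝ)).const_mul (t - s)
  have hlim : Tendsto h atTop (𝓝[≠] 0) :=
    tendsto_nhdsWithin_iff.2 ⟨hlim0, Eventually.of_forall fun m => (hpos m).ne'⟩
  have hlim' : Tendsto (fun m => -h m) atTop (𝓝[≠] 0) :=
    tendsto_nhdsWithin_iff.2 ⟨by simpa using hlim0.neg,
      Eventually.of_forall fun m => neg_ne_zero.2 (hpos m).ne'⟩
  have hS := hs.hasDerivAt.tendsto_slope_zero.comp hlim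
  have hT := ht.hasDerivAt.tendsto_slope_zero.comp hlim'
  refine ge_of_tendsto' (hT.sub hS) fun m => ?_
  have hend : s + ((m : ℝ) + 1) * h m = t := by
    have : (m : ℝ) + 1 ≠ 0 := by positivity
    simp only [hh]
    field_simp
    ring
  have hmem : ∀ x : ℝ, 0 ≤ x → x ≤ m + 1 → s + x * h m ∈ Icc s t := by
    intro x hx0 hx1
    have h1 := mul_nonneg hx0 (hpos m).le
    have h2 := mul_le_mul_of_nonneg_right hx1 (hpos m).le
    constructor <;> linarith
  have hsum := sum_norm_second_difference_le (hpos m).le hend hr hd hV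
  have hlow : -(L * (V * h m)) ≤ ∑ k ∈ Finset.range m,
      ((Φ (s + ((k + 1 : ℕ) : ℝ) * h m + h m) - Φ (s + ((k + 1 : ℕ) : ℝ) * h m)) -
        (Φ (s + (k : ℝ) * h m + h m) - Φ (s + (k : ℝ) * h m))) := by
    refine (neg_le_neg (mul_le_mul_of_nonneg_left hsum L.coe_nonneg)).trans ?_
    rw [Finset.mul_sum, ← Finset.sum_neg_distrib]
    refine Finset.sum_le_sum fun k hk => ?_
    have hk' : (k : ℝ) + 1 ≤ m := by exact_mod_cast Finset.mem_range.1 hk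
    have hk0 : (0 : ℝ) ≤ k := k.cast_nonneg
    have e1 : s + ((k : ℝ) + 1) * h m + h m = s + ((k : ℝ) + 2) * h m := by ring
    have e2 : s + (k : ℝ) * h m + h m = s + ((k : ℝ) + 1) * h m := by ring
    have := hf.second_difference_ge hL (hrD _ (hmem k hk0 (by linarith)))
      (hrD _ (hmem (k + 1) (by linarith) (by linarith)))
      (hrD _ (hmem (k + 2) (by linarith) (by linarith)))
    push_cast
    simp only [hΦ]
    rw [e1, e2]
    exact this
  rw [Finset.sum_range_sub (fun k : ℕ => Φ (s + (k : ℝ) * h m + h m) - Φ (s + (k : ℝ) * h m))]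
    at hlow
  have e3 : s + (m : ℝ) * h m + h m = t := by linarith
  have e4 : s + (m : ℝ) * h m = t + -h m := by linarith
  rw [e3, e4] at hlow
  simp only [Nat.cast_zero, zero_mul, add_zero] at hlow
  simp only [Function.comp, smul_eq_mul]
  have hp := hpos m
  rw [inv_neg, ← sub_nonneg]
  have : -(h m)⁻¹ * (Φ (t + -h m) - Φ t) - (h m)⁻¹ * (Φ (s + h m) - Φ s) - -(L * V) =
      (h m)⁻¹ * ((Φ t - Φ (t + -h m) - (Φ (s + h m) - Φ s)) - -(L * (V * h m))) := by
    field_simp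
    ring
  rw [this]
  exact mul_nonneg (inv_nonneg.2 hp.le) (sub_nonneg.2 hlow)

end SecondDifference

/-- At a point of an interval where a function is differentiable, its derivative is bounded by the
Lipschitz constant of its restriction to the interval. -/
lemma abs_deriv_le_of_lipschitzOnWith_Icc {g : ℝ → ℝ} {L : ℝ≥0} {a b t : ℝ} (hab : a < b)
    (hg : LipschitzOnWith L g (Icc a b)) (ht : t ∈ Icc a b) (hd : DifferentiableAt ℝ g t) :
    |deriv g t| ≤ L := by
  have hne : (𝓝[Icc a b \ {t}] t).NeBot := by
    have := (uniqueDiffOn_Icc hab t ht).accPt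
    rwa [accPt_principal_iff_nhdsWithin] at this
  have hlim := (hasDerivWithinAt_iff_tendsto_slope.1 (hd.hasDerivAt.hasDerivWithinAt
    (s := Icc a b))).abs
  refine le_of_tendsto hlim (eventually_nhdsWithin_of_forall fun x hx => ?_)
  have h1 := hg.dist_le_mul x hx.1 t ht
  have hxt : 0 < |x - t| := abs_pos.2 (sub_ne_zero.2 hx.2)
  rw [Real.dist_eq, Real.dist_eq] at h1
  rw [slope_def_field, abs_div]
  exact (div_le_iff₀ hxt).2 h1

/-- If the decrease of `g` on `S` is controlled by the increase of a function `W`, the variation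
of `g` is controlled by the oscillations of `g` and `W`. -/
lemma eVariationOn_le_of_sub_le {g W : ℝ → ℝ} {S : Set ℝ} {A B : ℝ}
    (hgW : ∀ x ∈ S, ∀ y ∈ S, x ≤ y → -(W y - W x) ≤ g y - g x)
    (hW : ∀ x ∈ S, ∀ y ∈ S, x ≤ y → 0 ≤ W y - W x)
    (hA : ∀ x ∈ S, ∀ y ∈ S, g y - g x ≤ A) (hB : ∀ x ∈ S, ∀ y ∈ S, W y - W x ≤ B) :
    eVariationOn g S ≤ ENNReal.ofReal (A + 2 * B) := by
  refine iSup_le ?_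
  rintro ⟨n, u, hu, huS⟩
  simp only [edist_dist]
  rw [← ENNReal.ofReal_sum_of_nonneg fun _ _ => dist_nonneg]
  refine ENNReal.ofReal_le_ofReal ?_
  have hstep : ∑ i ∈ Finset.range n, dist (g (u (i + 1))) (g (u i)) ≤
      ∑ i ∈ Finset.range n, ((g (u (i + 1)) + 2 * W (u (i + 1))) - (g (u i) + 2 * W (u i))) := by
    refine Finset.sum_le_sum fun i _ => ?_
    have h1 := hgW _ (huS i) _ (huS (i + 1)) (hu i.le_succ)
    have h2 := hW _ (huS i) _ (huS (i + 1)) (hu i.le_succ)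
    rw [Real.dist_eq, abs_le]
    constructor <;> linarith
  rw [Finset.sum_range_sub (fun i => g (u i) + 2 * W (u i))] at hstep
  have := hA _ (huS 0) _ (huS n)
  have := hB _ (huS 0) _ (huS n)
  linarith

/-- The derivative of a convex Lipschitz function along an arc-length-parametrized curve has
variation at most `2 L (1 + Var r')`. -/
lemma ConvexOn.derivVar_comp_le {E : Type*} [NormedAddCommGroup E] [NormedSpace ℝ E]
    {D : Set E} {f : E → ℝ} {L : ℝ≥0} (hf : ConvexOn ℝ D f) (hL : LipschitzOnWith L f D)
    {r : ℝ → E} {T : ℝ} (hT : 0 < T) (hr : IsArcLengthOn r T) (hrD : ∀ t ∈ Icc 0 T, r t ∈ D)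
    (hV : derivVar r T ≠ ⊤) :
    derivVar (fun t => f (r t)) T ≤ ENNReal.ofReal (2 * L * (1 + (derivVar r T).toReal)) := by
  obtain ⟨hlip, hae⟩ := hr
  have hd : ∀ᵐ u, u ∈ Icc 0 T → DifferentiableAt ℝ r u := by
    rw [ae_restrict_iff' measurableSet_Icc] at hae
    filter_upwards [hae] with u hu huI using (hu huI).1
  have hΦ : LipschitzOnWith L (fun t => f (r t)) (Icc 0 T) := by
    simpa [Function.comp_def] using hL.comp hlip hrD
  set P : ℝ → ℝ → Set ℝ := fun a b => {u | u ∈ Icc a b ∧ DifferentiableAt ℝ r u}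
  have hsub : ∀ {a b c d : ℝ}, c ≤ a → b ≤ d → P a b ⊆ P c d := fun hac hbd u hu =>
    ⟨⟨hac.trans hu.1.1, hu.1.2.trans hbd⟩, hu.2⟩
  have hfin : ∀ {a b : ℝ}, 0 ≤ a → b ≤ T → eVariationOn (deriv r) (P a b) ≠ ⊤ := fun ha hb =>
    ne_top_of_le_ne_top hV (eVariationOn.mono _ (hsub ha hb))
  set v : ℝ → ℝ := fun b => (eVariationOn (deriv r) (P 0 b)).toReal with hv
  have hv0 : ∀ b, 0 ≤ v b := fun b => ENNReal.toReal_nonneg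
  have hvT : ∀ b ≤ T, v b ≤ (derivVar r T).toReal := fun b hb =>
    ENNReal.toReal_mono hV (eVariationOn.mono _ (hsub le_rfl hb))
  have hvadd : ∀ x y, 0 ≤ x → x ≤ y → y ≤ T →
      (eVariationOn (deriv r) (P x y)).toReal ≤ v y - v x := by
    intro x y hx hxy hy
    have h1 : eVariationOn (deriv r) (P 0 x) + eVariationOn (deriv r) (P x y) ≤
        eVariationOn (deriv r) (P 0 y) :=
      (eVariationOn.add_le_union _ fun a ha b hb => ha.1.2.trans hb.1.1).trans
        (eVariationOn.mono _ (union_subset (hsub le_rfl hxy) (hsub hx le_rfl)))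
    have h2 := ENNReal.toReal_mono (hfin le_rfl hy) h1
    rw [ENNReal.toReal_add (hfin le_rfl (hxy.trans hy)) (hfin hx hy)] at h2
    linarith
  have hvmono : ∀ x y, 0 ≤ x → x ≤ y → y ≤ T → 0 ≤ v y - v x := fun x y hx hxy hy =>
    ENNReal.toReal_nonneg.trans (hvadd x y hx hxy hy)
  have hbound : ∀ x, x ∈ Icc 0 T ∧ DifferentiableAt ℝ (fun t => f (r t)) x →
      |deriv (fun t => f (r t)) x| ≤ L := fun x hx =>
    abs_deriv_le_of_lipschitzOnWith_Icc hT hΦ hx.1 hx.2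
  have key : derivVar (fun t => f (r t)) T ≤
      ENNReal.ofReal (2 * L + 2 * (L * (derivVar r T).toReal)) := by
    refine eVariationOn_le_of_sub_le (W := fun x => L * v x) ?_ ?_ ?_ ?_
    · intro x hx y hy hxy
      rcases hxy.eq_or_lt with rfl | hlt
      · simp
      have hIcc : Icc x y ⊆ Icc 0 T := Icc_subset_Icc hx.1.1 hy.1.2
      have h1 := hf.deriv_comp_sub_ge hL hlt (fun u hu => hrD u (hIcc hu)) (hlip.mono hIcc)
        (by filter_upwards [hd] with u hu huI using hu (hIcc huI))
        (hfin hx.1.1 hy.1.2) hx.2 hy.2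
      refine le_trans ?_ h1
      rw [← mul_sub]
      exact neg_le_neg (mul_le_mul_of_nonneg_left (hvadd x y hx.1.1 hxy hy.1.2) L.coe_nonneg)
    · intro x hx y hy hxy
      rw [← mul_sub]
      exact mul_nonneg L.coe_nonneg (hvmono x y hx.1.1 hxy hy.1.2)
    · intro x hx y hy
      have h1 := abs_le.1 (hbound x hx)
      have h2 := abs_le.1 (hbound y hy)
      linarith
    · intro x _ y hy
      rw [← mul_sub]
      refine mul_le_mul_of_nonneg_left ?_ L.coe_nonneg
      have := hvT y hy.1.2
      have := hv0 x
      linarith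
  refine key.trans (le_of_eq ?_)
  congr 1
  ring

/-- **Lemma 2.** Let `f₁ : ℝⁿ → ℝ` be a continuous convex function.  Then there
is a constant `c₂ = c₂(D, f₁) > 0` such that for every curve `r ∈ ℘̃(D)` one has
`Var(Φ₁'; 0, T_r) ≤ c₂·(1 + Var(r'; 0, T_r))`, where `Φ₁(t) = f₁(r(t))`. -/
theorem derivVar_of_continuous_convex
    (n : ℕ) (hn : 2 < n)
    (D : Set (EuclideanSpace ℝ (Fin n)))
    (hD_open : IsOpen D) (hD_conv : Convex ℝ D)
    (hD_bdd : Bornology.IsBounded D) (hD_ne : D.Nonempty)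
    (f₁ : EuclideanSpace ℝ (Fin n) → ℝ)
    (hf₁_cont : Continuous f₁)
    (hf₁_conv : ConvexOn ℝ Set.univ f₁) :
    ∃ c₂ : ℝ, 0 < c₂ ∧ ∀ (r : ℝ → EuclideanSpace ℝ (Fin n)) (T : ℝ),
      MemCurveClassTilde D r T →
        derivVar (fun t => f₁ (r t)) T
          ≤ ENNReal.ofReal c₂ * (1 + derivVar r T) := by
  obtain ⟨R, hR⟩ := hD_bdd.subset_closedBall 0
  obtain ⟨L, hL⟩ := LocallyLipschitzOn.exists_lipschitzOnWith_of_compact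
    (isCompact_closedBall (0 : EuclideanSpace ℝ (Fin n)) R)
    hf₁_conv.locallyLipschitz.locallyLipschitzOn
  refine ⟨2 * L + 1, by positivity, fun r T hrT => ?_⟩
  obtain ⟨hT, hr, hrD, -⟩ := hrT
  by_cases hV : derivVar r T = ⊤
  · rw [hV, add_top, ENNReal.mul_top (by simp; positivity)]
    exact le_top
  refine ((hf₁_conv.subset (subset_univ D) hD_conv).derivVar_comp_le (hL.mono hR) hT hr hrD
    hV).trans ?_
  have hV1 : 1 + derivVar r T = ENNReal.ofReal (1 + (derivVar r T).toReal) := by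
    rw [ENNReal.ofReal_add zero_le_one ENNReal.toReal_nonneg, ENNReal.ofReal_one,
      ENNReal.ofReal_toReal hV]
  rw [hV1, ← ENNReal.ofReal_mul (by positivity)]
  refine ENNReal.ofReal_le_ofReal (mul_le_mul_of_nonneg_right (by linarith) ?_)
  positivity
end

section
/- Let C ⊂ ℝ² be a compact convex set with nonempty interior and let r : [0,T] → ℝ² be a closed arc-length parametrization of the boundary of C (r is 1-Lipschitz, ‖r'(t)‖ = 1 at almost every t, r(0) = r(T), and r is injective on [0,T)). Then the variation of the derivative Var(r'; 0, T) is at most 2π; in particular, Var(r'; 0, T) is bounded by a constant independent of the curve r over the whole class of such boundary curves of convex compact subsets of a fixed bounded set. -/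
open Set MeasureTheory Filter Topology

/-- Two vectors of the plane orthogonal to a common nonzero vector are proportional. -/
lemma det_eq_zero_of_inner_eq_zero {e v w : EuclideanSpace ℝ (Fin 2)} (he : e ≠ 0)
    (hv : inner ℝ v e = 0) (hw : inner ℝ w e = 0) : v 0 * w 1 = v 1 * w 0 := by
  simp only [PiLp.inner_apply, Fin.sum_univ_two, RCLike.inner_apply, conj_trivial] at hv hw
  by_contra h
  apply he
  have h0 : (v 0 * w 1 - v 1 * w 0) * e 0 = 0 := by linear_combination w 1 * hv - v 1 * hw
  have h1 : (v 0 * w 1 - v 1 * w 0) * e 1 = 0 := by linear_combination v 0 * hw - w 0 * hv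
  have hne : v 0 * w 1 - v 1 * w 0 ≠ 0 := sub_ne_zero.2 h
  ext i
  fin_cases i
  · simpa using (mul_eq_zero.1 h0).resolve_left hne
  · simpa using (mul_eq_zero.1 h1).resolve_left hne

lemma exists_smul_eq_of_inner_eq_zero {e v w : EuclideanSpace ℝ (Fin 2)} (he : e ≠ 0)
    (hv : v ≠ 0) (hve : inner ℝ v e = 0) (hwe : inner ℝ w e = 0) : ∃ c : ℝ, w = c • v := by
  have hdet := det_eq_zero_of_inner_eq_zero he hve hwe
  by_cases h0 : v 0 = 0
  · have h1 : v 1 ≠ 0 := fun h1 => hv (by ext i; fin_cases i <;> simpa)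
    refine ⟨w 1 / v 1, ?_⟩
    ext i
    fin_cases i
    · have : w 0 = 0 := by
        rw [h0, zero_mul] at hdet
        exact (mul_eq_zero.1 hdet.symm).resolve_left h1
      simp [h0, this]
    · simp [h1]
  · refine ⟨w 0 / v 0, ?_⟩
    ext i
    fin_cases i
    · simp [h0]
    · simp only [PiLp.smul_apply, smul_eq_mul, Fin.mk_one]
      field_simp
      linarith

/-- A line meeting a planar convex body on both sides contains no frontier point strictly
between two points of the body. -/
lemma Convex.notMem_frontier_of_mem_openSegment {C : Set (EuclideanSpace ℝ (Fin 2))}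
    (hC : Convex ℝ C) (hint : (interior C).Nonempty) {e p q s x y : EuclideanSpace ℝ (Fin 2)}
    {c : ℝ} (hq : q ∈ C) (hs : s ∈ C) (hx : x ∈ C) (hy : y ∈ C) (hqs : q ≠ s)
    (hp : p ∈ openSegment ℝ q s) (hqc : inner ℝ q e = c) (hsc : inner ℝ s e = c)
    (hxc : inner ℝ x e < c) (hyc : c < inner ℝ y e) : p ∉ frontier C := by
  intro hpf
  have he : e ≠ 0 := by
    rintro rfl
    simp only [inner_zero_right] at hxc hyc
    linarith
  obtain ⟨g, hg⟩ := geometric_hahn_banach_open_point hC.interior isOpen_interior hpf.2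
  have hgC : ∀ a ∈ C, g a ≤ g p := by
    have hcl : closure (interior C) ⊆ {a | g a ≤ g p} :=
      closure_minimal (fun a ha => (hg a ha).le) (isClosed_le g.continuous continuous_const)
    intro a ha
    exact hcl (by
      rw [hC.closure_interior_eq_closure_of_nonempty_interior hint]
      exact subset_closure ha)
  obtain ⟨α, β, hα, hβ, hαβ, rfl⟩ := hp
  have hq' := hgC q hq
  have hs' := hgC s hs
  simp only [map_add, map_smul, smul_eq_mul] at hq' hs' hg hgC
  have hgqs : g q = g s := by
    obtain rfl : β = 1 - α := by linarith
    nlinarith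
  have hline : ∀ z, inner ℝ z e = c → g z = g q := by
    intro z hz
    obtain ⟨k, hk⟩ := exists_smul_eq_of_inner_eq_zero he (sub_ne_zero.2 hqs)
      (w := z - q) (by rw [inner_sub_left]; linarith) (by rw [inner_sub_left]; linarith)
    have := congrArg g hk
    rw [map_sub, map_smul, map_sub, hgqs, sub_self, smul_zero] at this
    rw [hgqs]; linarith
  have hgp : α * g q + β * g s = g q := by
    rw [← hgqs, ← add_mul, hαβ, one_mul]
  rw [hgp] at hg hgC
  obtain ⟨o, ho⟩ := hint
  have hcross : ∀ z ∈ C, ∀ θ : ℝ, 0 < θ → θ ≤ 1 →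
      inner ℝ (θ • o + (1 - θ) • z) e = c → False := by
    intro z hz θ hθ hθ1 h
    have h1 := hline _ h
    simp only [map_add, map_smul, smul_eq_mul] at h1
    nlinarith [hg o ho, hgC z hz]
  rcases le_total (inner ℝ o e) c with hoc | hoc
  · refine hcross y hy ((inner ℝ y e - c) / (inner ℝ y e - inner ℝ o e)) ?_ ?_ ?_
    · apply div_pos <;> linarith
    · rw [div_le_one (by linarith)]; linarith
    · have : inner ℝ y e - inner ℝ o e ≠ 0 := by linarith
      simp only [inner_add_left, inner_smul_left, conj_trivial]
      field_simp
      ring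
  · refine hcross x hx ((c - inner ℝ x e) / (inner ℝ o e - inner ℝ x e)) ?_ ?_ ?_
    · apply div_pos <;> linarith
    · rw [div_le_one (by linarith)]; linarith
    · have : inner ℝ o e - inner ℝ x e ≠ 0 := by linarith
      simp only [inner_add_left, inner_smul_left, conj_trivial]
      field_simp
      ring

/-- A line meeting a planar convex body on both sides meets its frontier in at most two points. -/
lemma Convex.not_three_frontier_points_on_line {C : Set (EuclideanSpace ℝ (Fin 2))}
    (hC : Convex ℝ C) (hcl : IsClosed C) (hint : (interior C).Nonempty)
    {e p q s x y : EuclideanSpace ℝ (Fin 2)} {c : ℝ}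
    (hp : p ∈ frontier C) (hq : q ∈ frontier C) (hs : s ∈ frontier C) (hx : x ∈ C) (hy : y ∈ C)
    (hpq : p ≠ q) (hqs : q ≠ s) (hps : p ≠ s)
    (hpc : inner ℝ p e = c) (hqc : inner ℝ q e = c) (hsc : inner ℝ s e = c)
    (hxc : inner ℝ x e < c) (hyc : c < inner ℝ y e) : False := by
  have he : e ≠ 0 := by
    rintro rfl
    simp only [inner_zero_right] at hxc hyc
    linarith
  have hcol : Collinear ℝ {p, q, s} := by
    rw [collinear_iff_of_mem (p₀ := p) (by simp)]
    refine ⟨q - p, ?_⟩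
    intro z hz
    have hzc : inner ℝ z e = c := by
      rcases hz with rfl | rfl | rfl <;> assumption
    obtain ⟨k, hk⟩ := exists_smul_eq_of_inner_eq_zero he (sub_ne_zero.2 hpq.symm)
      (w := z - p) (by rw [inner_sub_left]; linarith) (by rw [inner_sub_left]; linarith)
    exact ⟨k, by rw [vadd_eq_add, ← hk, sub_add_cancel]⟩
  have hsub := hcl.frontier_subset
  rcases hcol.wbtw_or_wbtw_or_wbtw with h | h | h <;> rw [← mem_segment_iff_wbtw] at h
  · exact hC.notMem_frontier_of_mem_openSegment hint (hsub hp) (hsub hs) hx hy hps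
      (mem_openSegment_of_ne_left_right hpq hqs.symm h) hpc hsc hxc hyc hq
  · exact hC.notMem_frontier_of_mem_openSegment hint (hsub hq) (hsub hp) hx hy hpq.symm
      (mem_openSegment_of_ne_left_right hqs hps h) hqc hpc hxc hyc hs
  · exact hC.notMem_frontier_of_mem_openSegment hint (hsub hs) (hsub hq) hx hy hqs.symm
      (mem_openSegment_of_ne_left_right hps.symm hpq.symm h) hsc hqc hxc hyc hp

/-- Along an injective parametrization of the frontier of a planar convex body, a linear
functional cannot take the values low, high, low, high in this order. -/
lemma Convex.frontier_not_low_high_low_high {C : Set (EuclideanSpace ℝ (Fin 2))}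
    (hC : Convex ℝ C) (hcl : IsClosed C) (hint : (interior C).Nonempty)
    {r : ℝ → EuclideanSpace ℝ (Fin 2)} {T : ℝ} (hcont : ContinuousOn r (Icc 0 T))
    (hinj : InjOn r (Ico 0 T)) (hr : ∀ t ∈ Icc 0 T, r t ∈ frontier C)
    (e : EuclideanSpace ℝ (Fin 2)) {c p₀ p₁ p₂ p₃ : ℝ}
    (h0 : 0 ≤ p₀) (h01 : p₀ < p₁) (h12 : p₁ < p₂) (h23 : p₂ < p₃) (h3 : p₃ ≤ T)
    (hc0 : inner ℝ (r p₀) e < c) (hc1 : c < inner ℝ (r p₁) e)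
    (hc2 : inner ℝ (r p₂) e < c) (hc3 : c < inner ℝ (r p₃) e) : False := by
  have hf : ContinuousOn (fun t => inner ℝ (r t) e) (Icc 0 T) := hcont.inner continuousOn_const
  obtain ⟨x, ⟨hx0, hx1⟩, hxc⟩ := intermediate_value_Ioo h01.le
    (hf.mono (Icc_subset_Icc h0 (by linarith))) ⟨hc0, hc1⟩
  obtain ⟨y, ⟨hy0, hy1⟩, hyc⟩ := intermediate_value_Ioo' h12.le
    (hf.mono (Icc_subset_Icc (by linarith) (by linarith))) ⟨hc2, hc1⟩
  obtain ⟨z, ⟨hz0, hz1⟩, hzc⟩ := intermediate_value_Ioo h23.le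
    (hf.mono (Icc_subset_Icc (by linarith) (by linarith))) ⟨hc2, hc3⟩
  have hne : ∀ {s t : ℝ}, 0 ≤ s → s < t → t < T → r s ≠ r t := fun h h' h'' heq =>
    h'.ne (hinj ⟨h, by linarith⟩ ⟨by linarith, h''⟩ heq)
  exact hC.not_three_frontier_points_on_line hcl hint
    (hr x ⟨by linarith, by linarith⟩) (hr y ⟨by linarith, by linarith⟩)
    (hr z ⟨by linarith, by linarith⟩)
    (hcl.frontier_subset (hr p₀ ⟨by linarith, by linarith⟩))
    (hcl.frontier_subset (hr p₁ ⟨by linarith, by linarith⟩))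
    (hne (by linarith) (by linarith) (by linarith))
    (hne (by linarith) (by linarith) (by linarith))
    (hne (by linarith) (by linarith) (by linarith)) hxc hyc hzc hc0 hc1

lemma HasDerivAt.exists_gt_right {f : ℝ → ℝ} {d s t : ℝ} (hf : HasDerivAt f d s) (hd : 0 < d)
    (hst : s < t) : ∃ x ∈ Ioo s t, f s < f x := by
  have h := (hasDerivAt_iff_tendsto_slope_left_right.1 hf).2.eventually (lt_mem_nhds hd)
  obtain ⟨x, hx, hxs⟩ := (h.and (Ioo_mem_nhdsGT hst)).exists
  refine ⟨x, hxs, ?_⟩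
  rw [slope_def_field, div_pos_iff_of_pos_right (sub_pos.2 hxs.1)] at hx
  linarith

lemma HasDerivAt.exists_gt_left {f : ℝ → ℝ} {d s t : ℝ} (hf : HasDerivAt f d t) (hd : d < 0)
    (hst : s < t) : ∃ x ∈ Ioo s t, f t < f x := by
  have h := (hasDerivAt_iff_tendsto_slope_left_right.1 hf).1.eventually (gt_mem_nhds hd)
  obtain ⟨x, hx, hxs⟩ := (h.and (Ioo_mem_nhdsLT hst)).exists
  refine ⟨x, hxs, ?_⟩
  rw [slope_def_field, div_neg_iff] at hx
  rcases hx with hx | hx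
  · linarith
  · linarith [hxs.2]

/-- Between a point of positive derivative and a later point of negative derivative, a function
takes a value larger than at both points. -/
lemma HasDerivAt.exists_gt_both {f : ℝ → ℝ} {d d' s t : ℝ} (hs : HasDerivAt f d s)
    (ht : HasDerivAt f d' t) (hd : 0 < d) (hd' : d' < 0) (hst : s < t) :
    ∃ x ∈ Ioo s t, f s < f x ∧ f t < f x := by
  obtain ⟨x, hx, hsx⟩ := hs.exists_gt_right hd hst
  obtain ⟨y, hy, hty⟩ := ht.exists_gt_left hd' hst
  rcases le_total (f x) (f y) with h | h
  · exact ⟨y, hy, hsx.trans_le h, hty⟩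
  · exact ⟨x, hx, hsx, hty.trans_le h⟩

lemma HasDerivAt.exists_lt_both {f : ℝ → ℝ} {d d' s t : ℝ} (hs : HasDerivAt f d s)
    (ht : HasDerivAt f d' t) (hd : d < 0) (hd' : 0 < d') (hst : s < t) :
    ∃ x ∈ Ioo s t, f x < f s ∧ f x < f t := by
  obtain ⟨x, hx, h1, h2⟩ := hs.neg.exists_gt_both ht.neg (neg_pos.2 hd) (neg_neg_iff_pos.2 hd') hst
  exact ⟨x, hx, neg_lt_neg_iff.1 h1, neg_lt_neg_iff.1 h2⟩

/-- If the values of `f` on `[0, T]`, `f 0 = f T`, never alternate twice around a level, then its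
derivative cannot have the signs `+, -, +, -` in this order. -/
lemma derivative_signs_not_alternating {f : ℝ → ℝ} {T : ℝ} (hclosed : f 0 = f T)
    (hlow : ∀ {c p₀ p₁ p₂ p₃ : ℝ}, 0 ≤ p₀ → p₀ < p₁ → p₁ < p₂ → p₂ < p₃ → p₃ ≤ T →
      f p₀ < c → c < f p₁ → f p₂ < c → c < f p₃ → False)
    (hhigh : ∀ {c p₀ p₁ p₂ p₃ : ℝ}, 0 ≤ p₀ → p₀ < p₁ → p₁ < p₂ → p₂ < p₃ → p₃ ≤ T →
      c < f p₀ → f p₁ < c → c < f p₂ → f p₃ < c → False)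
    {t₀ t₁ t₂ t₃ d₀ d₁ d₂ d₃ : ℝ} (h0 : 0 ≤ t₀) (h01 : t₀ < t₁) (h12 : t₁ < t₂) (h23 : t₂ < t₃)
    (h3 : t₃ ≤ T) (hd0 : HasDerivAt f d₀ t₀) (hd1 : HasDerivAt f d₁ t₁)
    (hd2 : HasDerivAt f d₂ t₂) (hd3 : HasDerivAt f d₃ t₃)
    (hp0 : 0 < d₀) (hn1 : d₁ < 0) (hp2 : 0 < d₂) (hn3 : d₃ < 0) : False := by
  obtain ⟨a, ⟨ha0, ha1⟩, hfa0, hfa1⟩ := hd0.exists_gt_both hd1 hp0 hn1 h01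
  obtain ⟨b, ⟨hb1, hb2⟩, hfb1, hfb2⟩ := hd1.exists_lt_both hd2 hn1 hp2 h12
  obtain ⟨c, ⟨hc2, hc3⟩, hfc2, hfc3⟩ := hd2.exists_gt_both hd3 hp2 hn3 h23
  have pos_of : f a ≤ f 0 → 0 < t₀ := fun h => h0.lt_of_ne (by rintro rfl; linarith)
  have lt_of : f c ≤ f T → t₃ < T := fun h => h3.lt_of_ne (by rintro rfl; linarith)
  by_cases hA : f a ≤ f 0
  · obtain ⟨m, hm, hma⟩ := exists_between (max_lt hfa0 (hfb1.trans hfa1))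
    rw [max_lt_iff] at hm
    exact hhigh le_rfl (pos_of hA) ha0 (ha1.trans hb1) (by linarith)
      (hma.trans_le hA) hm.1 hma hm.2
  by_cases hB : f c ≤ f T
  · obtain ⟨m, hm, hmc⟩ := exists_between (max_lt hfc3 (hfb2.trans hfc2))
    rw [max_lt_iff] at hm
    exact hlow (p₀ := b) (by linarith) (hb2.trans hc2) hc3 (lt_of hB) le_rfl hm.2 hmc hm.1
      (hmc.trans_le hB)
  push Not at hA hB
  rw [← hclosed] at hB
  obtain ⟨m, hm, hm'⟩ := exists_between (max_lt (lt_min hA hB)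
    (lt_min (hfb1.trans hfa1) (hfb2.trans hfc2)))
  rw [max_lt_iff] at hm
  rw [lt_min_iff] at hm'
  exact hlow le_rfl (h0.trans_lt ha0) (ha1.trans hb1) (hb2.trans hc2) (by linarith)
    hm.1 hm'.1 hm.2 hm'.2

lemma exists_eq_cos_sin (u : EuclideanSpace ℝ (Fin 2)) (hu : ‖u‖ = 1) :
    ∃ α ∈ Ioc (-Real.pi) Real.pi, u = !₂[Real.cos α, Real.sin α] := by
  have hnorm : ‖(⟨u 0, u 1⟩ : ℂ)‖ = 1 := by
    rw [Complex.norm_eq_sqrt_sq_add_sq, ← hu, EuclideanSpace.norm_eq]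
    simp [Fin.sum_univ_two]
  refine ⟨Complex.arg ⟨u 0, u 1⟩, Complex.arg_mem_Ioc _, ?_⟩
  have hc := Complex.norm_mul_cos_arg ⟨u 0, u 1⟩
  have hs := Complex.norm_mul_sin_arg ⟨u 0, u 1⟩
  rw [hnorm, one_mul] at hc hs
  ext i
  fin_cases i
  · simp [hc]
  · simp [hs]

lemma inner_cos_sin (α φ : ℝ) :
    inner ℝ (!₂[Real.cos α, Real.sin α] : EuclideanSpace ℝ (Fin 2)) !₂[Real.cos φ, Real.sin φ]
      = Real.cos (φ - α) := by
  rw [Real.cos_sub]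
  simp [PiLp.inner_apply, Fin.sum_univ_two]

lemma norm_cos_sin_sub_le (α β : ℝ) :
    ‖(!₂[Real.cos α, Real.sin α] : EuclideanSpace ℝ (Fin 2)) - !₂[Real.cos β, Real.sin β]‖
      ≤ |α - β| := by
  rw [EuclideanSpace.norm_eq, ← Real.sqrt_sq_eq_abs]
  apply Real.sqrt_le_sqrt
  simp only [Fin.sum_univ_two, PiLp.sub_apply, Real.norm_eq_abs, sq_abs]
  have h := Real.one_sub_sq_div_two_le_cos (x := α - β)
  rw [Real.cos_sub] at h
  simp
  nlinarith [Real.sin_sq_add_cos_sq α, Real.sin_sq_add_cos_sq β]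

/-- The directions of the plane separating `u` from `v` strictly. -/
def separatingAngles (u v : EuclideanSpace ℝ (Fin 2)) : Set ℝ :=
  {φ | inner ℝ u !₂[Real.cos φ, Real.sin φ] * inner ℝ v !₂[Real.cos φ, Real.sin φ] < 0}

lemma separatingAngles_comm (u v : EuclideanSpace ℝ (Fin 2)) :
    separatingAngles u v = separatingAngles v u := by
  simp only [separatingAngles, mul_comm]

lemma measurableSet_separatingAngles (u v : EuclideanSpace ℝ (Fin 2)) :
    MeasurableSet (separatingAngles u v) := by
  simp only [separatingAngles, PiLp.inner_apply, Fin.sum_univ_two, RCLike.inner_apply,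
    conj_trivial]
  refine (isOpen_lt ?_ continuous_const).measurableSet
  simp
  fun_prop

lemma intervalIntegrable_indicator_separatingAngles (u v : EuclideanSpace ℝ (Fin 2)) (a b : ℝ) :
    IntervalIntegrable ((separatingAngles u v).indicator 1 : ℝ → ℝ) volume a b := by
  rw [intervalIntegrable_iff]
  exact IntegrableOn.indicator (integrableOn_const (by simp)) (measurableSet_separatingAngles u v)

lemma periodic_indicator_separatingAngles (u v : EuclideanSpace ℝ (Fin 2)) :
    Function.Periodic ((separatingAngles u v).indicator 1 : ℝ → ℝ) Real.pi := by
  intro φ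
  have : φ + Real.pi ∈ separatingAngles u v ↔ φ ∈ separatingAngles u v := by
    simp only [separatingAngles, mem_ofPred_eq, PiLp.inner_apply, Fin.sum_univ_two,
      RCLike.inner_apply, conj_trivial]
    simp only [Matrix.cons_val_zero, Matrix.cons_val_one, Real.cos_add_pi,
      Real.sin_add_pi]
    ring_nf
  by_cases h : φ ∈ separatingAngles u v
  · simp [h, this.2 h]
  · simp [h, mt this.1 h]

lemma sub_le_integral_separatingAngles {α β : ℝ} (h : α ≤ β) (h' : β ≤ α + Real.pi) :
    β - α ≤ ∫ φ in (0 : ℝ)..Real.pi, (separatingAngles !₂[Real.cos α, Real.sin α]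
      !₂[Real.cos β, Real.sin β]).indicator 1 φ := by
  set S := separatingAngles !₂[Real.cos α, Real.sin α] !₂[Real.cos β, Real.sin β]
  have hper : Function.Periodic (S.indicator 1 : ℝ → ℝ) Real.pi :=
    periodic_indicator_separatingAngles _ _
  have hint : ∀ a b, IntervalIntegrable (S.indicator 1 : ℝ → ℝ) volume a b :=
    intervalIntegrable_indicator_separatingAngles _ _
  have hshift := hper.intervalIntegral_add_eq 0 (α + Real.pi / 2)
  rw [zero_add] at hshift
  rw [hshift]
  calc β - α = ∫ _ in (α + Real.pi / 2)..(β + Real.pi / 2), (1 : ℝ) := by simp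
    _ ≤ ∫ φ in (α + Real.pi / 2)..(β + Real.pi / 2), S.indicator 1 φ := by
        refine intervalIntegral.integral_mono_on_of_le_Ioo (by linarith) (by simp) (hint _ _) ?_
        rintro φ ⟨hφ, hφ'⟩
        have : φ ∈ S := by
          change inner ℝ _ _ * inner ℝ _ _ < 0
          rw [inner_cos_sin, inner_cos_sin]
          exact mul_neg_of_neg_of_pos
            (Real.cos_neg_of_pi_div_two_lt_of_lt (by linarith) (by linarith))
            (Real.cos_pos_of_mem_Ioo ⟨by linarith, by linarith⟩)
        simp [this]
    _ ≤ ∫ φ in (α + Real.pi / 2)..(α + Real.pi / 2 + Real.pi), S.indicator 1 φ := by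
        refine intervalIntegral.integral_mono_interval le_rfl (by linarith) (by linarith) ?_
          (hint _ _)
        exact Eventually.of_forall fun φ => indicator_nonneg (fun _ _ => zero_le_one) φ

/-- The distance of two unit vectors is at most the measure of the lines through the origin
that separate them. -/
lemma norm_sub_le_integral_separatingAngles {u v : EuclideanSpace ℝ (Fin 2)} (hu : ‖u‖ = 1)
    (hv : ‖v‖ = 1) :
    ‖u - v‖ ≤ ∫ φ in (0 : ℝ)..Real.pi, (separatingAngles u v).indicator 1 φ := by
  obtain ⟨α, hα, rfl⟩ := exists_eq_cos_sin u hu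
  obtain ⟨β, hβ, rfl⟩ := exists_eq_cos_sin v hv
  have key : ∀ {a b : ℝ}, a ≤ b → b ≤ a + Real.pi →
      ‖(!₂[Real.cos a, Real.sin a] : EuclideanSpace ℝ (Fin 2)) - !₂[Real.cos b, Real.sin b]‖ ≤
        ∫ φ in (0 : ℝ)..Real.pi, (separatingAngles !₂[Real.cos a, Real.sin a]
          !₂[Real.cos b, Real.sin b]).indicator 1 φ := fun {a b} h h' =>
    (norm_cos_sin_sub_le a b).trans
      ((abs_sub_comm a b ▸ abs_of_nonneg (sub_nonneg.2 h)).trans_le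
        (sub_le_integral_separatingAngles h h'))
  have main : ∀ {a b : ℝ}, a ≤ b → b ≤ a + 2 * Real.pi →
      ‖(!₂[Real.cos a, Real.sin a] : EuclideanSpace ℝ (Fin 2)) - !₂[Real.cos b, Real.sin b]‖ ≤
        ∫ φ in (0 : ℝ)..Real.pi, (separatingAngles !₂[Real.cos a, Real.sin a]
          !₂[Real.cos b, Real.sin b]).indicator 1 φ := by
    intro a b h h'
    rcases le_total b (a + Real.pi) with hab | hab
    · exact key h hab
    · have := key (a := b) (b := a + 2 * Real.pi) h' (by linarith)
      rwa [Real.cos_add_two_pi, Real.sin_add_two_pi, separatingAngles_comm, norm_sub_rev] at this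
  rcases le_total α β with h | h
  · exact main h (by linarith [hα.1, hβ.2])
  · rw [norm_sub_rev, separatingAngles_comm]
    exact main h (by linarith [hα.2, hβ.1])

/-- A sequence of reals that does not change sign strictly three times. -/
def NotThriceAlternating (x : ℕ → ℝ) : Prop :=
  ∀ ⦃i j k l : ℕ⦄, i < j → j < k → k < l → 0 < x i → x j < 0 → 0 < x k → x l < 0 → False

lemma not_three_sign_changes {x : ℕ → ℝ} (hx : NotThriceAlternating x)
    (hx' : NotThriceAlternating (-x)) {i j k : ℕ} (hij : i < j) (hjk : j < k)
    (hi : x i * x (i + 1) < 0) (hj : x j * x (j + 1) < 0) (hk : x k * x (k + 1) < 0) : False := by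
  wlog hpos : 0 < x i generalizing x
  · refine this hx' (by rwa [neg_neg]) (by simpa using hi) (by simpa using hj)
      (by simpa using hk) ?_
    have : x i ≠ 0 := by rintro h; simp [h] at hi
    simpa using lt_of_le_of_ne (not_lt.1 hpos) this
  have hi1 : x (i + 1) < 0 := by
    by_contra! h
    exact absurd hi (not_lt.2 (mul_nonneg hpos.le h))
  obtain ⟨p, hp, hpj, hpx⟩ : ∃ p, j ≤ p ∧ p ≤ j + 1 ∧ 0 < x p := by
    rcases mul_neg_iff.1 hj with h | h
    · exact ⟨j, le_rfl, by lia, h.1⟩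
    · exact ⟨j + 1, by lia, le_rfl, h.2⟩
  obtain ⟨q, hq, hqx⟩ : ∃ q, k ≤ q ∧ x q < 0 := by
    rcases mul_neg_iff.1 hk with h | h
    · exact ⟨k + 1, by lia, h.2⟩
    · exact ⟨k, le_rfl, h.1⟩
  have h1 : i + 1 ≠ p := by rintro rfl; linarith
  have h2 : p ≠ q := by rintro rfl; linarith
  exact hx (Nat.lt_succ_self i) (by lia) (by lia) hpos hi1 hpx hqx

/-- A sequence of unit vectors of the plane, no linear functional of which changes sign strictly
three times, has variation at most `2π`. -/
lemma sum_norm_sub_le_two_pi {u : ℕ → EuclideanSpace ℝ (Fin 2)} (hu : ∀ i, ‖u i‖ = 1)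
    (halt : ∀ e, NotThriceAlternating fun i => inner ℝ (u i) e) (n : ℕ) :
    ∑ i ∈ Finset.range n, ‖u (i + 1) - u i‖ ≤ 2 * Real.pi := by
  classical
  have hneg : ∀ e, NotThriceAlternating (-fun i => inner ℝ (u i) e) := by
    intro e
    have := halt (-e)
    simp only [inner_neg_right] at this
    exact this
  have hint := fun i => intervalIntegrable_indicator_separatingAngles (u i) (u (i + 1)) 0 Real.pi
  calc ∑ i ∈ Finset.range n, ‖u (i + 1) - u i‖
      ≤ ∑ i ∈ Finset.range n, ∫ φ in (0 : ℝ)..Real.pi,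
          (separatingAngles (u i) (u (i + 1))).indicator 1 φ := by
        refine Finset.sum_le_sum fun i _ => ?_
        rw [norm_sub_rev]
        exact norm_sub_le_integral_separatingAngles (hu i) (hu (i + 1))
    _ = ∫ φ in (0 : ℝ)..Real.pi, ∑ i ∈ Finset.range n,
          (separatingAngles (u i) (u (i + 1))).indicator 1 φ :=
        (intervalIntegral.integral_finsetSum fun i _ => hint i).symm
    _ ≤ ∫ _ in (0 : ℝ)..Real.pi, (2 : ℝ) := by
        refine intervalIntegral.integral_mono_on Real.pi_pos.le
          (by simpa [Finset.sum_fn] using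
            IntervalIntegrable.sum (Finset.range n) fun i _ => hint i) (by simp) fun φ _ => ?_
        simp only [indicator, Pi.one_apply, Finset.sum_boole]
        norm_cast
        by_contra! hcard
        obtain ⟨a, ha, b, hb, c, hc, hab, hac, hbc⟩ := Finset.two_lt_card.1 hcard
        replace ha := (Finset.mem_filter.1 ha).2
        replace hb := (Finset.mem_filter.1 hb).2
        replace hc := (Finset.mem_filter.1 hc).2
        have key := fun {i j k : ℕ} => not_three_sign_changes (i := i) (j := j) (k := k)
          (halt !₂[Real.cos φ, Real.sin φ]) (hneg _)
        rcases hab.lt_or_gt with h1 | h1 <;> rcases hac.lt_or_gt with h2 | h2 <;>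
          rcases hbc.lt_or_gt with h3 | h3
        · exact key h1 h3 ha hb hc
        · exact key h2 h3 ha hc hb
        · lia
        · exact key h2 h1 hc ha hb
        · exact key h1 h2 hb ha hc
        · lia
        · exact key h3 h2 hb hc ha
        · exact key h3 h1 hc hb ha
    _ = 2 * Real.pi := by simp [mul_comm]

section UnitSpeed

variable {E : Type*} [NormedAddCommGroup E] [InnerProductSpace ℝ E]

/-- A curve on the unit sphere, along which no linear functional takes both signs frequently,
converges. -/
lemma exists_tendsto_of_not_frequently_both_signs [FiniteDimensional ℝ E] {ι : Type*}
    {l : Filter ι} [l.NeBot] {g : ι → E} (hg : ∀ᶠ s in l, ‖g s‖ = 1)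
    (hsign : ∀ e, (∃ᶠ s in l, 0 < inner ℝ (g s) e) → (∃ᶠ s in l, inner ℝ (g s) e < 0) → False) :
    ∃ v, ‖v‖ = 1 ∧ Tendsto g l (𝓝 v) := by
  have hK : IsCompact (Metric.sphere (0 : E) 1) := isCompact_sphere 0 1
  have hmem : ∀ᶠ s in l, g s ∈ Metric.sphere (0 : E) 1 := by simpa using hg
  have hmap : Metric.sphere (0 : E) 1 ∈ map g l := hmem
  obtain ⟨v, hvK, hv⟩ := hK.exists_clusterPt (le_principal_iff.2 hmap)
  refine ⟨v, by simpa using hvK, hK.le_nhds_of_unique_clusterPt hmap fun w hwK hw => ?_⟩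
  have hv1 : ‖v‖ = 1 := by simpa using hvK
  have hw1 : ‖w‖ = 1 := by simpa using hwK
  by_contra hne
  have hlt : inner ℝ v w < 1 := (inner_lt_one_iff_real_of_norm_eq_one hv1 hw1).2 (Ne.symm hne)
  refine hsign (v - w) ?_ ?_
  · refine (mapClusterPt_def.2 hv).frequently (p := fun x => 0 < inner ℝ x (v - w)) ?_
    refine (continuous_id.inner continuous_const).continuousAt.eventually (lt_mem_nhds ?_)
    simp only [id, inner_sub_right, real_inner_self_eq_norm_sq, hv1]
    linarith
  · refine (mapClusterPt_def.2 hw).frequently (p := fun x => inner ℝ x (v - w) < 0) ?_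
    refine (continuous_id.inner continuous_const).continuousAt.eventually (gt_mem_nhds ?_)
    simp only [id, inner_sub_right, real_inner_self_eq_norm_sq, hw1, real_inner_comm v w]
    linarith [real_inner_comm v w]

/-- A Lipschitz function whose derivative is almost everywhere at least `c` increases with
speed at least `c`. -/
lemma mul_sub_le_of_le_deriv_ae {f : ℝ → ℝ} {a b c : ℝ} {K : NNReal} (hab : a ≤ b)
    (hf : LipschitzOnWith K f (Icc a b)) (hc : ∀ᵐ s, s ∈ Ioo a b → c ≤ deriv f s) :
    c * (b - a) ≤ f b - f a := by
  have hac : AbsolutelyContinuousOnInterval f a b :=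
    LipschitzOnWith.absolutelyContinuousOnInterval (by rwa [uIcc_of_le hab])
  rw [← hac.integral_deriv_eq_sub]
  calc c * (b - a) = ∫ _ in a..b, c := by simp [mul_comm]
    _ ≤ _ := by
      refine intervalIntegral.integral_mono_ae_restrict hab (by simp)
        hac.intervalIntegrable_deriv ?_
      rw [← restrict_Ioo_eq_restrict_Icc]
      exact (ae_restrict_iff' measurableSet_Ioo).2 hc

lemma inner_lipschitzOnWith {r : ℝ → E} {s : Set ℝ} (hr : LipschitzOnWith 1 r s) {v : E}
    (hv : ‖v‖ = 1) : LipschitzOnWith 1 (fun t => inner ℝ (r t) v) s := by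
  refine LipschitzOnWith.of_dist_le_mul fun x hx y hy => ?_
  rw [Real.dist_eq, ← inner_sub_left]
  calc |inner ℝ (r x - r y) v| ≤ ‖r x - r y‖ * ‖v‖ := abs_real_inner_le_norm _ _
    _ = dist (r x) (r y) := by rw [hv, mul_one, dist_eq_norm]
    _ ≤ _ := hr.dist_le_mul x hx y hy

/-- The points of an interval at which a curve has a derivative of norm one. -/
def unitSpeedSet (r : ℝ → E) (a b : ℝ) : Set ℝ :=
  {s | s ∈ Ioo a b ∧ DifferentiableAt ℝ r s ∧ ‖deriv r s‖ = 1}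

/-- A curve with speed one almost everywhere, the derivative of which does not alternate in
direction, has speed one at a left endpoint at which it is differentiable. -/
lemma norm_deriv_left_endpoint_eq_one [FiniteDimensional ℝ E] {r : ℝ → E} {a b : ℝ} (hab : a < b)
    (hr : LipschitzOnWith 1 r (Icc a b)) (hae : ∀ᵐ s, s ∈ Ioo a b → s ∈ unitSpeedSet r a b)
    (halt : ∀ e, ∀ s₀ ∈ unitSpeedSet r a b, ∀ s₁ ∈ unitSpeedSet r a b,
      ∀ s₂ ∈ unitSpeedSet r a b, ∀ s₃ ∈ unitSpeedSet r a b, s₀ < s₁ → s₁ < s₂ → s₂ < s₃ →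
      0 < inner ℝ (deriv r s₀) e → inner ℝ (deriv r s₁) e < 0 →
      0 < inner ℝ (deriv r s₂) e → inner ℝ (deriv r s₃) e < 0 → False)
    {w : E} (hw : HasDerivAt r w a) : ‖w‖ = 1 := by
  set G := unitSpeedSet r a b
  set l := 𝓝[>] a ⊓ 𝓟 G
  have hl : ∀ {P : ℝ → Prop}, (∃ᶠ s in l, P s) → ∀ x, a < x → ∃ s ∈ G, s < x ∧ P s := by
    intro P hP x hx
    obtain ⟨s, hs, hsx, hsG⟩ := (hP.and_eventually (inter_mem
      (mem_inf_of_left (Ioo_mem_nhdsGT hx)) (mem_inf_of_right (mem_principal_self G)))).exists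
    exact ⟨s, hsG, hsx.2, hs⟩
  have hne : l.NeBot := by
    rw [← frequently_true_iff_neBot, frequently_iff]
    intro U hU
    rw [mem_inf_principal, mem_nhdsGT_iff_exists_Ioo_subset] at hU
    obtain ⟨x, hx, hxU⟩ := hU
    have hxb : a < min x b := lt_min hx hab
    have hpos : volume (Ioo a (min x b)) ≠ 0 := by simpa using hxb
    have : ∃ᶠ s in ae volume, s ∈ Ioo a (min x b) := by
      rwa [frequently_ae_mem_iff]
    obtain ⟨s, hs, hsG⟩ := (this.and_eventually hae).exists
    exact ⟨s, hxU ⟨hs.1, hs.2.trans_le (min_le_left _ _)⟩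
      (hsG ⟨hs.1, hs.2.trans_le (min_le_right _ _)⟩), trivial⟩
  have hlG : ∀ᶠ s in l, s ∈ G := mem_inf_of_right (mem_principal_self G)
  obtain ⟨v, hv, hlim⟩ := exists_tendsto_of_not_frequently_both_signs (l := l) (g := deriv r)
    (hlG.mono fun s hs => hs.2.2) (fun e hp hn => by
      obtain ⟨s₃, h3, -, h3'⟩ := hl hn b hab
      obtain ⟨s₂, h2, h23, h2'⟩ := hl hp s₃ h3.1.1
      obtain ⟨s₁, h1, h12, h1'⟩ := hl hn s₂ h2.1.1
      obtain ⟨s₀, h0, h01, h0'⟩ := hl hp s₁ h1.1.1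
      exact halt e s₀ h0 s₁ h1 s₂ h2 s₃ h3 h01 h12 h23 h0' h1' h2' h3')
  have hslope := (hasDerivAt_iff_tendsto_slope_left_right.1 hw).2
  apply le_antisymm
  · refine le_of_tendsto hslope.norm ?_
    filter_upwards [Ioo_mem_nhdsGT hab] with x hx
    rw [slope_def_module, norm_smul, norm_inv, Real.norm_of_nonneg (sub_nonneg.2 hx.1.le),
      inv_mul_le_one₀ (sub_pos.2 hx.1)]
    have := hr.dist_le_mul x (Ioo_subset_Icc_self hx) a (left_mem_Icc.2 hab.le)
    rwa [dist_eq_norm, Real.dist_eq, abs_of_pos (sub_pos.2 hx.1), NNReal.coe_one, one_mul] at this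
  · have hwv : 1 ≤ inner ℝ w v := by
      refine le_of_forall_lt fun c hc => ?_
      obtain ⟨c', hcc', hc'⟩ := exists_between hc
      refine hcc'.trans_le (ge_of_tendsto (hslope.inner tendsto_const_nhds) ?_)
      have hev : ∀ᶠ s in l, c' < inner ℝ (deriv r s) v := by
        refine (hlim.inner tendsto_const_nhds).eventually (lt_mem_nhds ?_)
        rwa [real_inner_self_eq_norm_sq, hv, one_pow]
      have hev' := mem_nhdsGT_iff_exists_Ioo_subset.1 (mem_inf_principal.1 hev)
      obtain ⟨d, hd, hdG⟩ := hev'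
      filter_upwards [Ioo_mem_nhdsGT (lt_min hd hab)] with x hx
      have hxd := hx.2.trans_le (min_le_left _ _)
      have hxb := hx.2.trans_le (min_le_right _ _)
      have hmono := mul_sub_le_of_le_deriv_ae (c := c') hx.1.le
        (inner_lipschitzOnWith (hr.mono (Icc_subset_Icc_right hxb.le)) hv) (by
          filter_upwards [hae] with s hs hsx
          have hsG := hs ⟨hsx.1, hsx.2.trans hxb⟩
          have hder := hsG.2.1.hasDerivAt.inner ℝ (hasDerivAt_const s v)
          rw [hder.deriv]
          simpa using (hdG ⟨hsx.1, hsx.2.trans hxd⟩ hsG).le)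
      rw [slope_def_module, inner_smul_left, inner_sub_left, conj_trivial, inv_mul_eq_div,
        le_div_iff₀ (sub_pos.2 hx.1)]
      exact hmono
    calc 1 ≤ inner ℝ w v := hwv
      _ ≤ ‖w‖ * ‖v‖ := real_inner_le_norm w v
      _ = ‖w‖ := by rw [hv, mul_one]

lemma norm_deriv_right_endpoint_eq_one [FiniteDimensional ℝ E] {r : ℝ → E} {a b : ℝ} (hab : a < b)
    (hr : LipschitzOnWith 1 r (Icc a b)) (hae : ∀ᵐ s, s ∈ Ioo a b → s ∈ unitSpeedSet r a b)
    (halt : ∀ e, ∀ s₀ ∈ unitSpeedSet r a b, ∀ s₁ ∈ unitSpeedSet r a b,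
      ∀ s₂ ∈ unitSpeedSet r a b, ∀ s₃ ∈ unitSpeedSet r a b, s₀ < s₁ → s₁ < s₂ → s₂ < s₃ →
      0 < inner ℝ (deriv r s₀) e → inner ℝ (deriv r s₁) e < 0 →
      0 < inner ℝ (deriv r s₂) e → inner ℝ (deriv r s₃) e < 0 → False)
    {w : E} (hw : HasDerivAt r w b) : ‖w‖ = 1 := by
  have hder : ∀ s, deriv (fun t => r (-t)) s = -deriv r (-s) := fun s => deriv_comp_neg r s
  have hG : ∀ s, s ∈ unitSpeedSet (fun t => r (-t)) (-b) (-a) ↔ -s ∈ unitSpeedSet r a b := by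
    intro s
    have hd : DifferentiableAt ℝ (fun t => r (-t)) s ↔ DifferentiableAt ℝ r (-s) :=
      differentiableAt_comp_neg
    simp only [unitSpeedSet, mem_ofPred_eq, hder, norm_neg, hd, mem_Ioo, neg_lt, lt_neg]
    tauto
  rw [← norm_neg]
  refine norm_deriv_left_endpoint_eq_one (r := fun t => r (-t)) (neg_lt_neg hab) ?_ ?_ ?_ ?_
  · refine LipschitzOnWith.of_dist_le_mul fun x hx y hy => ?_
    have := hr.dist_le_mul (-x) ⟨le_neg.1 hx.2, neg_le.1 hx.1⟩ (-y) ⟨le_neg.1 hy.2, neg_le.1 hy.1⟩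
    rwa [dist_neg_neg] at this
  · have := (Measure.measurePreserving_neg (volume : Measure ℝ)).quasiMeasurePreserving.ae hae
    filter_upwards [this] with s hs hsI
    exact (hG s).2 (hs ⟨lt_neg.1 hsI.2, neg_lt.1 hsI.1⟩)
  · intro e s₀ h0 s₁ h1 s₂ h2 s₃ h3 h01 h12 h23 hp0 hn1 hp2 hn3
    simp only [hder, inner_neg_left, neg_pos, neg_neg_iff_pos] at hp0 hn1 hp2 hn3
    exact halt e _ ((hG _).1 h3) _ ((hG _).1 h2) _ ((hG _).1 h1) _ ((hG _).1 h0)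
      (neg_lt_neg h23) (neg_lt_neg h12) (neg_lt_neg h01) hn3 hp2 hn1 hp0
  · have h : HasDerivAt r w (-(-b)) := by rwa [neg_neg]
    simpa [Function.comp_def] using h.scomp (-b) (hasDerivAt_neg (-b))

end UnitSpeed

/-- If `r : [0,T] → ℝ²` is a closed arc-length parametrization of the boundary of
a compact convex set `C ⊆ ℝ²` with nonempty interior, then
`Var(r'; 0, T) ≤ 2π`.  In particular `Var(r'; 0, T)` is bounded by a constant
independent of the curve over the whole class of such boundary curves. -/
theorem derivVar_boundary_convex_le_two_pi
    (C : Set (EuclideanSpace ℝ (Fin 2)))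
    (hC_comp : IsCompact C) (hC_conv : Convex ℝ C)
    (hC_int : (interior C).Nonempty)
    (r : ℝ → EuclideanSpace ℝ (Fin 2)) (T : ℝ) (hT : 0 < T)
    (harc : IsArcLengthOn r T)
    (hclosed : r 0 = r T)
    (hinj : Set.InjOn r (Set.Ico 0 T))
    (himg : r '' Set.Icc 0 T = frontier C) :
    derivVar r T ≤ ENNReal.ofReal (2 * Real.pi) := by
  have hlip := harc.1
  have hcont := hlip.continuousOn
  have hr : ∀ t ∈ Icc 0 T, r t ∈ frontier C := fun t ht => himg ▸ mem_image_of_mem r ht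
  have hlow := fun e {c p₀ p₁ p₂ p₃ : ℝ} => hC_conv.frontier_not_low_high_low_high
    hC_comp.isClosed hC_int hcont hinj hr e (c := c) (p₀ := p₀) (p₁ := p₁) (p₂ := p₂) (p₃ := p₃)
  have halt : ∀ e, ∀ s₀ ∈ Icc 0 T, DifferentiableAt ℝ r s₀ → ∀ s₁, DifferentiableAt ℝ r s₁ →
      ∀ s₂, DifferentiableAt ℝ r s₂ → ∀ s₃ ∈ Icc 0 T, DifferentiableAt ℝ r s₃ →
      s₀ < s₁ → s₁ < s₂ → s₂ < s₃ →
      0 < inner ℝ (deriv r s₀) e → inner ℝ (deriv r s₁) e < 0 →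
      0 < inner ℝ (deriv r s₂) e → inner ℝ (deriv r s₃) e < 0 → False := by
    intro e s₀ hs0 h0 s₁ h1 s₂ h2 s₃ hs3 h3 h01 h12 h23
    have hd : ∀ {s}, DifferentiableAt ℝ r s →
        HasDerivAt (fun t => inner ℝ (r t) e) (inner ℝ (deriv r s) e) s := fun {s} h => by
      simpa using h.hasDerivAt.inner ℝ (hasDerivAt_const s e)
    refine derivative_signs_not_alternating (T := T) (by rw [hclosed]) (hlow e) ?_
      hs0.1 h01 h12 h23 hs3.2 (hd h0) (hd h1) (hd h2) (hd h3)
    intro c p₀ p₁ p₂ p₃ g0 g01 g12 g23 g3 i0 i1 i2 i3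
    refine hlow (-e) (c := -c) g0 g01 g12 g23 g3 ?_ ?_ ?_ ?_ <;> rw [inner_neg_right] <;> linarith
  have hae : ∀ᵐ s, s ∈ Icc 0 T → DifferentiableAt ℝ r s ∧ ‖deriv r s‖ = 1 :=
    (ae_restrict_iff' measurableSet_Icc).1 harc.2
  have hunit : ∀ t ∈ Icc 0 T, DifferentiableAt ℝ r t → ‖deriv r t‖ = 1 := by
    intro t ht hdiff
    have hGae : ∀ {a b : ℝ}, 0 ≤ a → b ≤ T → ∀ᵐ s, s ∈ Ioo a b → s ∈ unitSpeedSet r a b := by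
      intro a b ha hb
      filter_upwards [hae] with s hs hsI
      exact ⟨hsI, hs ⟨ha.trans hsI.1.le, hsI.2.le.trans hb⟩⟩
    have hGalt : ∀ {a b : ℝ}, 0 ≤ a → b ≤ T → ∀ e, ∀ s₀ ∈ unitSpeedSet r a b,
        ∀ s₁ ∈ unitSpeedSet r a b, ∀ s₂ ∈ unitSpeedSet r a b, ∀ s₃ ∈ unitSpeedSet r a b,
        s₀ < s₁ → s₁ < s₂ → s₂ < s₃ →
        0 < inner ℝ (deriv r s₀) e → inner ℝ (deriv r s₁) e < 0 →
        0 < inner ℝ (deriv r s₂) e → inner ℝ (deriv r s₃) e < 0 → False :=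
      fun ha hb e s₀ h0 s₁ h1 s₂ h2 s₃ h3 =>
        halt e s₀ ⟨ha.trans h0.1.1.le, h0.1.2.le.trans hb⟩ h0.2.1 s₁ h1.2.1 s₂ h2.2.1 s₃
          ⟨ha.trans h3.1.1.le, h3.1.2.le.trans hb⟩ h3.2.1
    rcases ht.2.lt_or_eq with htT | rfl
    · exact norm_deriv_left_endpoint_eq_one htT (hlip.mono (Icc_subset_Icc_left ht.1))
        (hGae ht.1 le_rfl) (hGalt ht.1 le_rfl) hdiff.hasDerivAt
    · exact norm_deriv_right_endpoint_eq_one hT hlip (hGae le_rfl le_rfl)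
        (hGalt le_rfl le_rfl) hdiff.hasDerivAt
  refine iSup_le ?_
  rintro ⟨n, t, htm, ht⟩
  have hsum := sum_norm_sub_le_two_pi (u := fun i => deriv r (t i))
    (fun i => hunit _ (ht i).1 (ht i).2) (fun e i j k l hij hjk hkl hi hj hk hl => by
      have hlt : ∀ {p q : ℕ}, p < q → inner ℝ (deriv r (t p)) e ≠ inner ℝ (deriv r (t q)) e →
          t p < t q := fun hpq hne => (htm hpq.le).lt_of_ne fun h => hne (by rw [h])
      exact halt e _ (ht i).1 (ht i).2 _ (ht j).2 _ (ht k).2 _ (ht l).1 (ht l).2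
        (hlt hij (by linarith)) (hlt hjk (by linarith)) (hlt hkl (by linarith)) hi hj hk hl) n
  simp only [edist_dist, dist_eq_norm]
  rw [← ENNReal.ofReal_sum_of_nonneg fun _ _ => norm_nonneg _]
  exact ENNReal.ofReal_le_ofReal hsum
end
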